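/- Let k ≥ 2, L ≥ 3, and let T : Π_L → Σ_k be the map constructed from the proper subshift Π_L. If y ∈ Trans(Π_L) satisfies Case (i) in (Π_L, σ) for some i ∈ {1,…,6}, then T(y) satisfies Case (i') in (Σ_k, σ). -/

import Mathlib

open Filter Topology MeasureTheory

/-- Upper density of a set of naturals. -/
noncomputable def upperDensity (S : Set ℕ) : ℝ :=
  Filter.limsup (fun n => ((S ∩ Set.Iio n).ncard : ℝ) / n) Filter.atTop

/-- Lower density of a set of naturals. -/
noncomputable def lowerDensity (S : Set ℕ) : ℝ :=
  Filter.liminf (fun n => ((S ∩ Set.Iio n).ncard : ℝ) / n) Filter.atTop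

/-- Banach upper density: limsup over the interval length of the maximal
proportion of `S` in an interval of that length. -/
noncomputable def banachUpperDensity (S : Set ℕ) : ℝ :=
  Filter.limsup (fun N => ⨆ a : ℕ, ((S ∩ Set.Ico a (a + N)).ncard : ℝ) / N) Filter.atTop

/-- Banach lower density. -/
noncomputable def banachLowerDensity (S : Set ℕ) : ℝ :=
  Filter.liminf (fun N => ⨅ a : ℕ, ((S ∩ Set.Ico a (a + N)).ncard : ℝ) / N) Filter.atTop

/-- The shift map on the full shift `Σ_k = {0, …, k-1}^ℕ`. -/
def shift {k : ℕ} (x : ℕ → Fin k) : ℕ → Fin k := fun n => x (n + 1)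

/-- The metric `d(x,y) = Σ_{n ≥ 1} δ(x_n, y_n)/2^n` on `Σ_k` (sequences indexed from `0`). -/
noncomputable def shiftDist {k : ℕ} (x y : ℕ → Fin k) : ℝ :=
  ∑' n : ℕ, if x n = y n then 0 else (1 / 2) ^ (n + 1)

/-- The open ball `B_ε(x)` for the metric `shiftDist`. -/
def sball {k : ℕ} (x : ℕ → Fin k) (ε : ℝ) : Set (ℕ → Fin k) := {y | shiftDist x y < ε}

/-- `N(x, U) = {n ≥ 1 : σ^n(x) ∈ U}`. -/
def visits {k : ℕ} (x : ℕ → Fin k) (U : Set (ℕ → Fin k)) : Set ℕ :=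
  {n | 1 ≤ n ∧ shift^[n] x ∈ U}

/-- A point is recurrent if `N(x, B_ε(x)) ≠ ∅` for every `ε > 0`. -/
def Recurrent {k : ℕ} (x : ℕ → Fin k) : Prop := ∀ ε > (0 : ℝ), (visits x (sball x ε)).Nonempty

/-- A point is Banach recurrent if `N(x, B_ε(x))` has positive Banach upper density
for every `ε > 0`. -/
def BanachRecurrent {k : ℕ} (x : ℕ → Fin k) : Prop :=
  ∀ ε > (0 : ℝ), 0 < banachUpperDensity (visits x (sball x ε))

/-- Statistical ω-limit set w.r.t. a density notion `ξ`:
`ω_ξ(x) = {y : ξ(N(x, B_ε(y))) > 0 for all ε > 0}`. -/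
def statOmega {k : ℕ} (ξ : Set ℕ → ℝ) (x : ℕ → Fin k) : Set (ℕ → Fin k) :=
  {y | ∀ ε > (0 : ℝ), 0 < ξ (visits x (sball y ε))}

/-- The usual ω-limit set of `x` under the shift. -/
def omegaLim {k : ℕ} (x : ℕ → Fin k) : Set (ℕ → Fin k) :=
  {y | ∀ ε > (0 : ℝ), ∀ N : ℕ, ∃ n ≥ N, shift^[n] x ∈ sball y ε}

/-- Density of a subset of `Σ_k` w.r.t. the metric `shiftDist`. -/
def ShiftDense {k : ℕ} (A : Set (ℕ → Fin k)) : Prop :=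
  ∀ x : ℕ → Fin k, ∀ ε > (0 : ℝ), ∃ y ∈ A, shiftDist x y < ε

/-- Closure of a subset of `Σ_k` w.r.t. the metric `shiftDist`. -/
def shiftClosure {k : ℕ} (A : Set (ℕ → Fin k)) : Set (ℕ → Fin k) :=
  {z | ∀ ε > (0 : ℝ), ∃ y ∈ A, shiftDist z y < ε}

/-- `Φ^{(n)}_{xy}(t)`: the proportion of times `0 ≤ i < n` with `d(σ^i x, σ^i y) < t`. -/
noncomputable def PhiN {k : ℕ} (x y : ℕ → Fin k) (n : ℕ) (t : ℝ) : ℝ :=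
  (({i | i < n ∧ shiftDist (shift^[i] x) (shift^[i] y) < t}).ncard : ℝ) / n

/-- A pair is DC1 (distributionally chaotic of type 1) if `Φ_{xy}(s) = 0` for some `s > 0`
and `Φ*_{xy}(t) = 1` for all `t > 0`. -/
def DC1Pair {k : ℕ} (x y : ℕ → Fin k) : Prop :=
  (∃ s > (0 : ℝ), Filter.liminf (fun n => PhiN x y n s) Filter.atTop = 0) ∧
  (∀ t > (0 : ℝ), Filter.limsup (fun n => PhiN x y n t) Filter.atTop = 1)

/-- A set with at least two points is DC1-scrambled if every pair of distinct points is DC1. -/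
def DC1Scrambled {k : ℕ} (S : Set (ℕ → Fin k)) : Prop :=
  S.Nontrivial ∧ ∀ x ∈ S, ∀ y ∈ S, x ≠ y → DC1Pair x y

/-- `strictOrEq true A B` means `A ⊊ B`; `strictOrEq false A B` means `A = B`. -/
def strictOrEq {α : Type*} (b : Bool) (A B : Set α) : Prop := if b then A ⊂ B else A = B

/-- The patterns of (strict ⊊ = `true` / equality = `false`) for the three inclusions
`ω_{B_*} ⊆ ω_{d̲} ⊆ ω_{d̄} ⊆ ω_{B*}` in Cases (1)–(6). -/
def caseFlags : Fin 6 → Bool × Bool × Bool :=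
  ![(true, false, false), (true, false, true), (false, true, false),
    (true, true, false), (false, true, true), (true, true, true)]

/-- `x` satisfies Case (i), i = 1,…,6: the chain
`ω_{B_*}(x) ⊆ ω_{d̲}(x) ⊆ ω_{d̄}(x) ⊆ ω_{B*}(x) = ω_σ(x)` with strictness pattern given by
`caseFlags i`, and the last inclusion an equality. -/
def SatCase {k : ℕ} (i : Fin 6) (x : ℕ → Fin k) : Prop :=
  strictOrEq (caseFlags i).1 (statOmega banachLowerDensity x) (statOmega lowerDensity x) ∧
  strictOrEq (caseFlags i).2.1 (statOmega lowerDensity x) (statOmega upperDensity x) ∧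
  strictOrEq (caseFlags i).2.2 (statOmega upperDensity x) (statOmega banachUpperDensity x) ∧
  statOmega banachUpperDensity x = omegaLim x

/-- `x` satisfies Case (i'), i = 1,…,6: as in Case (i) but the last inclusion
`ω_{B*}(x) ⊆ ω_σ(x)` is strict. -/
def SatCase' {k : ℕ} (i : Fin 6) (x : ℕ → Fin k) : Prop :=
  strictOrEq (caseFlags i).1 (statOmega banachLowerDensity x) (statOmega lowerDensity x) ∧
  strictOrEq (caseFlags i).2.1 (statOmega lowerDensity x) (statOmega upperDensity x) ∧
  strictOrEq (caseFlags i).2.2 (statOmega upperDensity x) (statOmega banachUpperDensity x) ∧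
  statOmega banachUpperDensity x ⊂ omegaLim x
/-- A subshift: a nonempty, closed (w.r.t. the metric `shiftDist`), shift-invariant subset. -/
def IsSubshift {k : ℕ} (P : Set (ℕ → Fin k)) : Prop :=
  P.Nonempty ∧ shiftClosure P ⊆ P ∧ ∀ x ∈ P, shift x ∈ P

/-- The first `n` symbols of `y` as a finite word. -/
def prefixWord {k : ℕ} (y : ℕ → Fin k) (n : ℕ) : List (Fin k) :=
  List.ofFn (fun i : Fin n => y i)

/-- A finite word occurs in (the language of) `P` if it is the initial word of
some point of `P`. -/
def IsWordIn {k : ℕ} (w : List (Fin k)) (P : Set (ℕ → Fin k)) : Prop :=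
  ∃ x ∈ P, ∀ i : Fin w.length, x i = w.get i

/-- Data for the construction of the map `T`: an enumeration `C` of all (nonempty) finite
words of the subshift `P`, and a nonempty finite word `A1` not occurring in `P`. -/
structure TData (k : ℕ) (P : Set (ℕ → Fin k)) where
  C : ℕ → List (Fin k)
  A1 : List (Fin k)
  A1_ne : A1 ≠ []
  A1_not : ¬ IsWordIn A1 P
  C_in : ∀ n, IsWordIn (C n) P
  C_surj : ∀ w : List (Fin k), w ≠ [] → IsWordIn w P → ∃ n, C n = w

/-- The words `A_n` of the construction (indexed from `0`, so `TData.A y 0` is the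
paper's `A_1`): `A_{n+1} = A_n B_n A_n`, where `B_n = C_n Y_n ⋯ Y_n` consists of the
word `C_n` followed by `|A_n|²` copies of the initial word `Y_n` of `y` (paper's `Y_n`,
of length `n`, is `prefixWord y (n+1)` in our `0`-based indexing). -/
def TData.A {k : ℕ} {P : Set (ℕ → Fin k)} (D : TData k P) (y : ℕ → Fin k) :
    ℕ → List (Fin k)
  | 0 => D.A1
  | n + 1 =>
      D.A y n ++
        (D.C n ++ (List.replicate ((D.A y n).length ^ 2) (prefixWord y (n + 1))).flatten) ++
        D.A y n

/-- The requirement `|C_n| = o(|A_n|)` as `n → ∞`. -/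
def TData.Small {k : ℕ} {P : Set (ℕ → Fin k)} (D : TData k P) : Prop :=
  ∀ y : ℕ → Fin k,
    Filter.Tendsto (fun n => ((D.C n).length : ℝ) / ((D.A y n).length))
      Filter.atTop (nhds 0)

/-- The map `T`: `T(y) = lim_n A_n` is the sequence whose `i`-th symbol is the `i`-th
symbol of `A_n` for every large `n` (the words `A_n` are nested prefixes of each other,
and `|A_{i+1}| > i`, so the `i`-th symbol of `A_{i+1}` is well defined). -/
def TData.T {k : ℕ} {P : Set (ℕ → Fin k)} (D : TData k P) (y : ℕ → Fin k) : ℕ → Fin k :=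
  fun i => if h : i < (D.A y (i + 1)).length then (D.A y (i + 1)).get ⟨i, h⟩ else y i
/-- The subshift of finite type `Π_L ⊆ Σ_k`: sequences in which no `L` consecutive
symbols are all equal. -/
def PiL (k L : ℕ) : Set (ℕ → Fin k) :=
  {x | ∀ i : ℕ, ∃ j₁ j₂ : ℕ, j₁ < L ∧ j₂ < L ∧ x (i + j₁) ≠ x (i + j₂)}


lemma aux_liminf_pos (u : ℕ → ℝ) (h0 : ∀ n, 0 ≤ u n) (h1 : ∀ n, u n ≤ 1) :
    0 < Filter.liminf u Filter.atTop ↔ ∃ c > 0, ∀ᶠ n in Filter.atTop, c ≤ u n := by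
  have hb : Filter.IsBoundedUnder (· ≥ ·) Filter.atTop u :=
    Filter.isBoundedUnder_of ⟨0, fun n => h0 n⟩
  have hcb : Filter.IsCoboundedUnder (· ≥ ·) Filter.atTop u :=
    (Filter.isBoundedUnder_of ⟨1, fun n => h1 n⟩ :
      Filter.IsBoundedUnder (· ≤ ·) Filter.atTop u).isCoboundedUnder_ge
  constructor
  · intro h
    refine ⟨Filter.liminf u Filter.atTop / 2, by linarith, ?_⟩
    have := Filter.eventually_lt_of_lt_liminf (f := Filter.atTop) (u := u)
      (b := Filter.liminf u Filter.atTop / 2) (by linarith) hb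
    exact this.mono fun n hn => hn.le
  · rintro ⟨c, hc, h⟩
    exact lt_of_lt_of_le hc (Filter.le_liminf_of_le hcb h)

lemma aux_limsup_pos (u : ℕ → ℝ) (h0 : ∀ n, 0 ≤ u n) (h1 : ∀ n, u n ≤ 1) :
    0 < Filter.limsup u Filter.atTop ↔ ∃ c > 0, ∃ᶠ n in Filter.atTop, c ≤ u n := by
  have hb : Filter.IsBoundedUnder (· ≤ ·) Filter.atTop u :=
    Filter.isBoundedUnder_of ⟨1, fun n => h1 n⟩
  have hcb : Filter.IsCoboundedUnder (· ≤ ·) Filter.atTop u :=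
    (Filter.isBoundedUnder_of ⟨0, fun n => h0 n⟩ :
      Filter.IsBoundedUnder (· ≥ ·) Filter.atTop u).isCoboundedUnder_le
  constructor
  · intro h
    refine ⟨Filter.limsup u Filter.atTop / 2, by linarith, ?_⟩
    have := Filter.frequently_lt_of_lt_limsup (f := Filter.atTop) (u := u)
      (b := Filter.limsup u Filter.atTop / 2) hcb (by linarith)
    exact this.mono fun n hn => hn.le
  · rintro ⟨c, hc, h⟩
    exact lt_of_lt_of_le hc (Filter.le_limsup_of_frequently_le h hb)

/-- counting -/
noncomputable def cnt (S : Set ℕ) (a N : ℕ) : ℝ :=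
  open Classical in ∑ i ∈ Finset.range N, if a + i ∈ S then (1 : ℝ) else 0

lemma cnt_eq (S : Set ℕ) (a N : ℕ) : ((S ∩ Set.Ico a (a + N)).ncard : ℝ) = cnt S a N := by
  classical
  unfold cnt
  rw [Finset.sum_boole]
  congr 1
  rw [← Set.ncard_coe_finset]
  symm
  apply Set.ncard_congr (fun i _ => a + i)
  · intro i hi
    simp at hi ⊢
    exact ⟨hi.2, hi.1⟩
  · intro i j _ _ h
    omega
  · intro b hb
    simp at hb ⊢
    exact ⟨b - a, ⟨by omega, by rw [Nat.add_sub_cancel' hb.2.1]; exact hb.1⟩, by omega⟩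

lemma cnt_eq0 (S : Set ℕ) (N : ℕ) : ((S ∩ Set.Iio N).ncard : ℝ) = cnt S 0 N := by
  rw [← cnt_eq]
  congr 3
  ext i; simp

lemma cnt_nonneg (S : Set ℕ) (a N : ℕ) : 0 ≤ cnt S a N :=
  Finset.sum_nonneg fun i _ => by split_ifs <;> norm_num

lemma cnt_le (S : Set ℕ) (a N : ℕ) : cnt S a N ≤ N := by
  unfold cnt
  refine (Finset.sum_le_card_nsmul _ _ 1 ?_).trans (by simp)
  intro i _
  split_ifs <;> norm_num

lemma cnt_mono {S S' : Set ℕ} {a a' N : ℕ} (h : ∀ i < N, a + i ∈ S → a' + i ∈ S') :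
    cnt S a N ≤ cnt S' a' N := by
  unfold cnt
  refine Finset.sum_le_sum ?_
  intro i hi
  have := h i (Finset.mem_range.1 hi)
  split_ifs with h1 h2
  · norm_num
  · exact absurd (this h1) h2
  · norm_num
  · norm_num

lemma cnt_div_le (S : Set ℕ) (a N : ℕ) : cnt S a N / N ≤ 1 := by
  rcases Nat.eq_zero_or_pos N with h | h
  · subst h; simp
  · rw [div_le_one (by exact_mod_cast h)]; exact cnt_le _ _ _

lemma cnt_div_nonneg (S : Set ℕ) (a N : ℕ) : 0 ≤ cnt S a N / N :=
  div_nonneg (cnt_nonneg _ _ _) (by positivity)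

lemma lower_pos (S : Set ℕ) : 0 < lowerDensity S ↔
    ∃ c > 0, ∀ᶠ n : ℕ in Filter.atTop, c * n ≤ cnt S 0 n := by
  unfold lowerDensity
  simp_rw [cnt_eq0]
  rw [aux_liminf_pos _ (fun n => cnt_div_nonneg _ _ _) (fun n => cnt_div_le _ _ _)]
  refine exists_congr fun c => and_congr_right fun hc => ?_
  refine Filter.eventually_congr ?_
  filter_upwards [Filter.eventually_gt_atTop 0] with n hn
  rw [le_div_iff₀ (by exact_mod_cast hn)]

lemma upper_pos (S : Set ℕ) : 0 < upperDensity S ↔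
    ∃ c > 0, ∃ᶠ n : ℕ in Filter.atTop, c * n ≤ cnt S 0 n := by
  unfold upperDensity
  simp_rw [cnt_eq0]
  rw [aux_limsup_pos _ (fun n => cnt_div_nonneg _ _ _) (fun n => cnt_div_le _ _ _)]
  refine exists_congr fun c => and_congr_right fun hc => ?_
  refine Filter.frequently_congr ?_
  filter_upwards [Filter.eventually_gt_atTop 0] with n hn
  rw [le_div_iff₀ (by exact_mod_cast hn)]

lemma bdd_cnt (S : Set ℕ) (N : ℕ) : BddAbove (Set.range fun a : ℕ => cnt S a N / N) :=
  ⟨1, by rintro _ ⟨a, rfl⟩; exact cnt_div_le _ _ _⟩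

lemma bdd_cnt' (S : Set ℕ) (N : ℕ) : BddBelow (Set.range fun a : ℕ => cnt S a N / N) :=
  ⟨0, by rintro _ ⟨a, rfl⟩; exact cnt_div_nonneg _ _ _⟩

lemma bupper_pos (S : Set ℕ) : 0 < banachUpperDensity S ↔
    ∃ c > 0, ∃ᶠ n : ℕ in Filter.atTop, ∃ a, c * n ≤ cnt S a n := by
  unfold banachUpperDensity
  simp_rw [cnt_eq]
  rw [aux_limsup_pos]
  · constructor
    · rintro ⟨c, hc, h⟩
      refine ⟨c / 2, by linarith, ?_⟩
      refine (h.and_eventually (Filter.eventually_gt_atTop 0)).mono ?_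
      rintro n ⟨hn, hpos⟩
      obtain ⟨a, ha⟩ := exists_lt_of_lt_ciSup (lt_of_lt_of_le (by linarith : c / 2 < c) hn)
      refine ⟨a, ?_⟩
      rw [← le_div_iff₀ (by exact_mod_cast hpos)]
      exact ha.le
    · rintro ⟨c, hc, h⟩
      refine ⟨c, hc, ?_⟩
      refine (h.and_eventually (Filter.eventually_gt_atTop 0)).mono ?_
      rintro n ⟨⟨a, ha⟩, hpos⟩
      rw [← le_div_iff₀ (by exact_mod_cast hpos)] at ha
      exact ha.trans (le_ciSup (bdd_cnt S n) a)
  · intro n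
    exact (cnt_div_nonneg S 0 n).trans (le_ciSup (bdd_cnt S n) 0)
  · intro n
    exact ciSup_le fun a => cnt_div_le _ _ _

lemma blower_pos (S : Set ℕ) : 0 < banachLowerDensity S ↔
    ∃ c > 0, ∀ᶠ n : ℕ in Filter.atTop, ∀ a, c * n ≤ cnt S a n := by
  unfold banachLowerDensity
  simp_rw [cnt_eq]
  rw [aux_liminf_pos]
  · refine exists_congr fun c => and_congr_right fun hc => ?_
    refine Filter.eventually_congr ?_
    filter_upwards [Filter.eventually_gt_atTop 0] with n hn
    rw [le_ciInf_iff (bdd_cnt' S n)]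
    refine forall_congr' fun a => ?_
    rw [le_div_iff₀ (by exact_mod_cast hn)]
  · intro n
    exact le_ciInf fun a => cnt_div_nonneg _ _ _
  · intro n
    exact (ciInf_le (bdd_cnt' S n) 0).trans (cnt_div_le _ _ _)

lemma shift_iter {k : ℕ} (x : ℕ → Fin k) (n j : ℕ) : shift^[n] x j = x (n + j) := by
  induction n generalizing x with
  | zero => simp
  | succ n ih =>
    rw [Function.iterate_succ_apply, ih]
    unfold shift
    congr 1; omega

lemma summ {k : ℕ} (x y : ℕ → Fin k) :
    Summable (fun n : ℕ => if x n = y n then (0 : ℝ) else (1 / 2) ^ (n + 1)) := by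
  refine Summable.of_nonneg_of_le (fun n => ?_) (fun n => ?_)
    (summable_geometric_of_lt_one (r := (1/2:ℝ)) (by norm_num) (by norm_num))
  · split_ifs <;> positivity
  · split_ifs
    · positivity
    · exact pow_le_pow_of_le_one (by norm_num) (by norm_num) (by omega)

lemma tsum_small (f : ℕ → ℝ) (hf : Summable f) (hle : ∀ n, f n ≤ (1 / 2) ^ (n + 1)) (m : ℕ)
    (h : ∀ j < m, f j = 0) : ∑' n, f n ≤ (1 / 2) ^ m := by
  have e1 := hf.sum_add_tsum_nat_add m
  have e2 : ∑ j ∈ Finset.range m, f j = 0 :=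
    Finset.sum_eq_zero fun j hj => h j (Finset.mem_range.1 hj)
  have hg : HasSum (fun n : ℕ => (1/2:ℝ)^(m+1) * (1/2)^n) ((1/2)^(m+1) * 2) :=
    hasSum_geometric_two.mul_left _
  have h2 : ((1/2:ℝ)^(m+1) * 2) = (1/2)^m := by rw [pow_succ]; ring
  have e3 : ∑' n, f (n + m) ≤ ∑' n : ℕ, (1/2:ℝ)^(m+1) * (1/2)^n := by
    refine Summable.tsum_le_tsum (fun n => ?_) ((summable_nat_add_iff m).2 hf) hg.summable
    refine (hle _).trans (le_of_eq ?_)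
    rw [← pow_add, show n + m + 1 = m + 1 + n by omega]
  rw [hg.tsum_eq, h2] at e3
  linarith

lemma dist_small {k : ℕ} (z w : ℕ → Fin k) (m : ℕ) (h : ∀ j < m, w j = z j) :
    shiftDist z w ≤ (1 / 2) ^ m := by
  unfold shiftDist
  refine tsum_small _ (summ z w) (fun n => ?_) m (fun j hj => ?_)
  · split_ifs
    · positivity
    · exact le_rfl
  · rw [if_pos (h j hj).symm]

lemma ball_of_agree (ε : ℝ) (hε : 0 < ε) : ∃ m : ℕ, ∀ {k : ℕ} (z w : ℕ → Fin k),
    (∀ j < m, w j = z j) → w ∈ sball z ε := by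
  obtain ⟨m, hm⟩ := exists_pow_lt_of_lt_one hε (by norm_num : (1/2:ℝ) < 1)
  exact ⟨m, fun z w h => lt_of_le_of_lt (dist_small z w m h) hm⟩

lemma agree_of_ball {k : ℕ} (m : ℕ) (z w : ℕ → Fin k) (h : w ∈ sball z ((1/2)^m)) :
    ∀ j < m, w j = z j := by
  intro j hj
  by_contra hne
  have h1 : shiftDist z w < (1/2)^m := h
  have h2 := (summ z w).le_tsum j (fun i _ => by split_ifs <;> positivity)
  rw [if_neg (fun h => hne h.symm)] at h2
  have h3 : (1/2:ℝ)^m ≤ (1/2)^(j+1) := pow_le_pow_of_le_one (by norm_num) (by norm_num) (by omega)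
  unfold shiftDist at h1
  linarith

/-- visits to cylinders -/
def VV {k : ℕ} (x z : ℕ → Fin k) (m : ℕ) : Set ℕ := {n | 1 ≤ n ∧ ∀ j < m, x (n + j) = z j}

lemma stat_iff {k : ℕ} (ξ : Set ℕ → ℝ) (hξ : ∀ S S' : Set ℕ, S ⊆ S' → 0 < ξ S → 0 < ξ S')
    (x z : ℕ → Fin k) : z ∈ statOmega ξ x ↔ ∀ m, 0 < ξ (VV x z m) := by
  constructor
  · intro h m
    refine hξ _ _ ?_ (h ((1/2)^m) (by positivity))
    rintro n ⟨hn, h2⟩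
    refine ⟨hn, fun j hj => ?_⟩
    rw [← shift_iter x]
    exact agree_of_ball m z _ h2 j hj
  · intro h ε hε
    obtain ⟨m, hm⟩ := ball_of_agree ε hε
    refine hξ _ _ ?_ (h m)
    rintro n ⟨hn, h2⟩
    refine ⟨hn, hm _ _ fun j hj => ?_⟩
    rw [shift_iter]; exact h2 j hj

lemma omega_iff {k : ℕ} (x z : ℕ → Fin k) : z ∈ omegaLim x ↔
    ∀ m N : ℕ, ∃ n ≥ N, ∀ j < m, x (n + j) = z j := by
  constructor
  · intro h m N
    obtain ⟨n, hn, h2⟩ := h ((1/2)^m) (by positivity) N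
    refine ⟨n, hn, fun j hj => ?_⟩
    rw [← shift_iter x]
    exact agree_of_ball m z _ h2 j hj
  · intro h ε hε N
    obtain ⟨m, hm⟩ := ball_of_agree ε hε
    obtain ⟨n, hn, h2⟩ := h m N
    refine ⟨n, hn, hm _ _ fun j hj => ?_⟩
    rw [shift_iter]; exact h2 j hj

lemma mono_l (S S' : Set ℕ) (h : S ⊆ S') : 0 < lowerDensity S → 0 < lowerDensity S' := by
  rw [lower_pos, lower_pos]
  rintro ⟨c, hc, H⟩
  exact ⟨c, hc, H.mono fun n hn => hn.trans (cnt_mono fun i _ hi => h hi)⟩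

lemma mono_u (S S' : Set ℕ) (h : S ⊆ S') : 0 < upperDensity S → 0 < upperDensity S' := by
  rw [upper_pos, upper_pos]
  rintro ⟨c, hc, H⟩
  exact ⟨c, hc, H.mono fun n hn => hn.trans (cnt_mono fun i _ hi => h hi)⟩

lemma mono_bl (S S' : Set ℕ) (h : S ⊆ S') :
    0 < banachLowerDensity S → 0 < banachLowerDensity S' := by
  rw [blower_pos, blower_pos]
  rintro ⟨c, hc, H⟩
  exact ⟨c, hc, H.mono fun n hn a => (hn a).trans (cnt_mono fun i _ hi => h hi)⟩

lemma mono_bu (S S' : Set ℕ) (h : S ⊆ S') :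
    0 < banachUpperDensity S → 0 < banachUpperDensity S' := by
  rw [bupper_pos, bupper_pos]
  rintro ⟨c, hc, H⟩
  exact ⟨c, hc, H.mono fun n ⟨a, hn⟩ => ⟨a, hn.trans (cnt_mono fun i _ hi => h hi)⟩⟩

/-- abstract structure of `x = T y` -/
structure XS {k : ℕ} (P : Set (ℕ → Fin k)) (x y : ℕ → Fin k) (a c : ℕ → ℕ) : Prop where
  h0 : 1 ≤ a 0
  ha : ∀ n, a (n + 1) = a n + c n + (n + 1) * (a n) ^ 2 + a n
  hC : ∀ n, ∃ p ∈ P, ∀ i < c n, x (a n + i) = p i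
  hY : ∀ n, ∀ q < (a n) ^ 2, ∀ s < n + 1, x (a n + c n + q * (n + 1) + s) = y s
  hA : ∀ n, ∀ i < a n, x (a n + c n + (n + 1) * (a n) ^ 2 + i) = x i
  hlim : Filter.Tendsto (fun n => (c n : ℝ) / a n) Filter.atTop (nhds 0)

lemma flat_get {α : Type*} (w : List α) (Q q s : ℕ) (hq : q < Q) (hs : s < w.length) :
    (List.replicate Q w).flatten[q * w.length + s]? = w[s]? := by
  induction Q generalizing q with
  | zero => omega
  | succ Q ih =>
    rw [List.replicate_succ, List.flatten_cons]
    cases q with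
    | zero => simp [List.getElem?_append, hs]
    | succ q =>
      rw [List.getElem?_append_right (by nlinarith)]
      rw [← ih q (by omega)]
      congr 1
      rw [Nat.succ_mul]; omega

lemma A_len {k : ℕ} {P : Set (ℕ → Fin k)} (D : TData k P) (y : ℕ → Fin k) (n : ℕ) :
    (D.A y (n+1)).length = (D.A y n).length + (D.C n).length + (n + 1) * ((D.A y n).length) ^ 2
      + (D.A y n).length := by
  simp [TData.A, prefixWord]
  ring

lemma A_len_ge {k : ℕ} {P : Set (ℕ → Fin k)} (D : TData k P) (y : ℕ → Fin k) (n : ℕ) :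
    n + 1 ≤ (D.A y n).length := by
  induction n with
  | zero => exact List.length_pos_iff.2 D.A1_ne
  | succ n ih => rw [A_len]; omega

lemma A_pre {k : ℕ} {P : Set (ℕ → Fin k)} (D : TData k P) (y : ℕ → Fin k) (n m : ℕ) (h : n ≤ m) :
    D.A y n <+: D.A y m := by
  induction m, h using Nat.le_induction with
  | base => exact List.prefix_rfl
  | succ m hm ih =>
    refine ih.trans ?_
    rw [TData.A, List.append_assoc]
    exact List.prefix_append _ _

lemma T_get {k : ℕ} {P : Set (ℕ → Fin k)} (D : TData k P) (y : ℕ → Fin k) (n i : ℕ)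
    (h : i < (D.A y n).length) : (D.A y n)[i]? = some (D.T y i) := by
  have h1 : i < (D.A y (i+1)).length := by have := A_len_ge D y (i+1); omega
  have h2 : (D.A y (i+1))[i]? = some (D.T y i) := by
    rw [TData.T, dif_pos h1]
    simp
  rcases le_total n (i+1) with hle | hle
  · rw [← h2]
    have := (A_pre D y _ _ hle).getElem h
    rw [List.getElem?_eq_getElem h, List.getElem?_eq_getElem h1, this]
  · rw [← h2]
    have := (A_pre D y _ _ hle).getElem h1
    rw [List.getElem?_eq_getElem h, List.getElem?_eq_getElem h1, this]

lemma T_XS {k : ℕ} {P : Set (ℕ → Fin k)} (D : TData k P) (hD : D.Small) (y : ℕ → Fin k) :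
    XS P (D.T y) y (fun n => (D.A y n).length) (fun n => (D.C n).length) := by
  refine ⟨A_len_ge D y 0, A_len D y, ?_, ?_, ?_, hD y⟩
  · intro n
    obtain ⟨p, hp, h⟩ := D.C_in n
    refine ⟨p, hp, fun i hi => ?_⟩
    have h1 := T_get D y (n+1) ((D.A y n).length + i) (by rw [A_len]; omega)
    rw [TData.A, List.append_assoc, List.getElem?_append_right (by omega), List.append_assoc,
      List.getElem?_append_left (by omega)] at h1
    have h2 := h ⟨i, hi⟩
    rw [h2]
    simp [hi] at h1
    simp [h1]
  · intro n q hq s hs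
    have hb : q * (n + 1) + s < (n+1) * ((D.A y n).length) ^ 2 := by nlinarith
    have h1 := T_get D y (n+1) ((D.A y n).length + (D.C n).length + q * (n+1) + s)
      (by rw [A_len]; omega)
    rw [TData.A, List.append_assoc, List.getElem?_append_right (by omega), List.append_assoc,
      List.getElem?_append_right (by omega), List.getElem?_append_left (by
        have h5 : (List.replicate ((D.A y n).length ^ 2) (prefixWord y (n + 1))).flatten.length
          = (n + 1) * ((D.A y n).length) ^ 2 := by
          simp [prefixWord]; ring
        omega)] at h1
    have h3 := flat_get (prefixWord y (n+1)) ((D.A y n).length ^ 2) q s hq (by simp [prefixWord]; omega)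
    have h4 : (prefixWord y (n+1)).length = n + 1 := by simp [prefixWord]
    rw [h4] at h3
    rw [show (D.A y n).length + (D.C n).length + q * (n+1) + s - (D.A y n).length - (D.C n).length
      = q * (n+1) + s by omega, h3] at h1
    rw [prefixWord, List.getElem?_ofFn, dif_pos hs] at h1
    exact (Option.some_injective _ h1).symm
  · intro n i hi
    have h1 := T_get D y (n+1) ((D.A y n).length + (D.C n).length +
      (n + 1) * ((D.A y n).length) ^ 2 + i) (by rw [A_len]; omega)
    have h5 : (D.C n ++ (List.replicate ((D.A y n).length ^ 2) (prefixWord y (n + 1))).flatten).length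
      = (D.C n).length + (n + 1) * ((D.A y n).length) ^ 2 := by
      simp [prefixWord]; ring
    rw [TData.A, List.append_assoc, List.getElem?_append_right (by omega),
      List.getElem?_append_right (by omega), h5, show (D.A y n).length + (D.C n).length +
      (n + 1) * ((D.A y n).length) ^ 2 + i - (D.A y n).length - ((D.C n).length + (n + 1) * ((D.A y n).length) ^ 2) = i by omega, T_get D y n i hi] at h1
    exact (Option.some_injective _ h1).symm

section density

lemma cnt_add (S : Set ℕ) (a M N : ℕ) : cnt S a (M + N) = cnt S a M + cnt S (a + M) N := by
  unfold cnt
  rw [Finset.sum_range_add]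
  classical
  congr 1
  refine Finset.sum_congr rfl fun i _ => if_congr ?_ rfl rfl
  rw [add_assoc]

lemma XS.a_ge {k : ℕ} {P : Set (ℕ → Fin k)} {x y : ℕ → Fin k} {a c : ℕ → ℕ} (H : XS P x y a c)
    (n : ℕ) : n + 1 ≤ a n := by
  induction n with
  | zero => exact H.h0
  | succ n ih => rw [H.ha]; omega

lemma XS.a_ge2 {k : ℕ} {P : Set (ℕ → Fin k)} {x y : ℕ → Fin k} {a c : ℕ → ℕ} (H : XS P x y a c)
    (n : ℕ) : n * n ≤ a n := by
  cases n with
  | zero => simp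
  | succ n =>
    rw [H.ha]
    have := H.a_ge n
    nlinarith

lemma XS.a_mono {k : ℕ} {P : Set (ℕ → Fin k)} {x y : ℕ → Fin k} {a c : ℕ → ℕ} (H : XS P x y a c) :
    StrictMono a := by
  refine strictMono_nat_of_lt_succ fun n => ?_
  rw [H.ha]
  have := H.a_ge n
  nlinarith

lemma XS.locate {k : ℕ} {P : Set (ℕ → Fin k)} {x y : ℕ → Fin k} {a c : ℕ → ℕ} (H : XS P x y a c)
    (K t : ℕ) (h : a K ≤ t) : ∃ n ≥ K, a n ≤ t ∧ t ≤ a (n + 1) := by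
  have hex : ∃ j, t < a j := ⟨t, by have := H.a_ge t; omega⟩
  have h1 := Nat.find_spec hex
  have h2 : K < Nat.find hex := H.a_mono.lt_iff_lt.1 (lt_of_le_of_lt h h1)
  refine ⟨Nat.find hex - 1, by omega, ?_, ?_⟩
  · exact not_lt.1 (Nat.find_min hex (m := Nat.find hex - 1) (by omega))
  · rw [Nat.sub_add_cancel (by omega)]; exact h1.le

lemma XS.ev {k : ℕ} {P : Set (ℕ → Fin k)} {x y : ℕ → Fin k} {a c : ℕ → ℕ} (H : XS P x y a c)
    (m : ℕ) (ε : ℝ) (hε : 0 < ε) : ∀ᶠ n : ℕ in Filter.atTop,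
      (c n : ℝ) ≤ ε * a n ∧ (m : ℝ) + 1 ≤ ε * (n + 1) ∧ (n : ℝ) + 1 ≤ ε * a n := by
  obtain ⟨K, hK⟩ := exists_nat_gt (((m : ℝ) + 3) / ε)
  rw [div_lt_iff₀ hε] at hK
  filter_upwards [H.hlim.eventually (gt_mem_nhds hε), Filter.eventually_ge_atTop K,
    Filter.eventually_ge_atTop 1] with n h1 h2 h3
  have ha : (0:ℝ) < a n := by have := H.a_ge n; exact_mod_cast (by omega : 0 < a n)
  have ha2 : (n:ℝ) * n ≤ a n := by exact_mod_cast H.a_ge2 n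
  have h2' : (K:ℝ) ≤ n := by exact_mod_cast h2
  have h3' : (1:ℝ) ≤ n := by exact_mod_cast h3
  have h4 : (m:ℝ) + 3 ≤ ε * n := by nlinarith
  have hm : (0:ℝ) ≤ m := by positivity
  refine ⟨?_, by nlinarith, ?_⟩
  · rw [div_lt_iff₀ ha] at h1; exact h1.le
  · have : (n:ℝ) * 2 ≤ ε * n * n := by nlinarith
    nlinarith

lemma cnt_err (S : Set ℕ) (b N : ℕ) (f : ℝ) (h0 : 0 ≤ f) (h1 : f ≤ 1) :
    |cnt S b N - f * N| ≤ N := by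
  have e1 := cnt_nonneg S b N
  have e2 := cnt_le S b N
  have e3 : (0:ℝ) ≤ N := by positivity
  rw [abs_le]
  constructor <;> nlinarith

lemma XS.block {k : ℕ} {P : Set (ℕ → Fin k)} {x y : ℕ → Fin k} {a c : ℕ → ℕ} (H : XS P x y a c)
    (z : ℕ → Fin k) (m n q : ℕ) (hq : q < (a n) ^ 2) :
    |cnt (VV x z m) (a n + c n + q * (n + 1)) (n + 1) - cnt (VV y z m) 0 (n + 1)| ≤ m + 1 := by
  classical
  unfold cnt
  rw [← Finset.sum_sub_distrib]
  refine (Finset.abs_sum_le_sum_abs _ _).trans ?_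
  have hle : ∀ s ∈ Finset.range (n+1),
      |(if a n + c n + q * (n + 1) + s ∈ VV x z m then (1:ℝ) else 0) -
        (if 0 + s ∈ VV y z m then (1:ℝ) else 0)| ≤
      (if s = 0 then (1:ℝ) else 0) + (if n + 1 < s + m then (1:ℝ) else 0) := by
    intro s hs
    rw [Finset.mem_range] at hs
    by_cases h : s = 0 ∨ n + 1 < s + m
    · have : (1:ℝ) ≤ (if s = 0 then (1:ℝ) else 0) + (if n + 1 < s + m then (1:ℝ) else 0) := by
        rcases h with h | h
        · rw [if_pos h]; split_ifs <;> norm_num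
        · rw [if_pos h]; split_ifs <;> norm_num
      refine le_trans ?_ this
      split_ifs <;> norm_num
    · push Not at h
      have : (a n + c n + q * (n + 1) + s ∈ VV x z m) ↔ (0 + s ∈ VV y z m) := by
        unfold VV
        simp only [Set.mem_ofPred_eq, zero_add]
        have e1 : (1 ≤ a n + c n + q * (n + 1) + s) ↔ 1 ≤ s := by omega
        rw [e1]
        refine and_congr_right fun _ => forall_congr' fun j => forall_congr' fun hj => ?_
        rw [add_assoc _ s j, H.hY n q hq (s + j) (by omega)]
      simp only [this, sub_self, abs_zero]
      split_ifs <;> norm_num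
  refine (Finset.sum_le_sum hle).trans ?_
  rw [Finset.sum_add_distrib, add_comm]
  refine add_le_add ?_ ?_
  · rw [Finset.sum_boole]
    have : (Finset.range (n+1)).filter (fun s => n + 1 < s + m) ⊆ Finset.Ico (n+1-m) (n+1) := by
      intro s hs
      simp at hs ⊢
      omega
    have := Finset.card_le_card this
    rw [Nat.card_Ico] at this
    exact_mod_cast (by omega : _ ≤ m)
  · rw [Finset.sum_boole]
    have : (Finset.range (n+1)).filter (fun s => s = 0) ⊆ {0} := by
      intro s hs
      simp at hs ⊢
      omega
    have := Finset.card_le_card this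
    exact_mod_cast this

lemma XS.blocks {k : ℕ} {P : Set (ℕ → Fin k)} {x y : ℕ → Fin k} {a c : ℕ → ℕ} (H : XS P x y a c)
    (z : ℕ → Fin k) (m n q : ℕ) (hq : q ≤ (a n) ^ 2) (f : ℝ)
    (hf : cnt (VV y z m) 0 (n + 1) = f * (n + 1)) :
    |cnt (VV x z m) (a n + c n) (q * (n + 1)) - f * (q * (n + 1))| ≤ q * (m + 1) := by
  induction q with
  | zero => simp [cnt]
  | succ q ih =>
    have h1 := ih (by omega)
    have h2 := H.block z m n q (by omega)
    rw [Nat.succ_mul, cnt_add]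
    rw [hf] at h2
    push_cast
    rw [abs_le] at h1 h2 ⊢
    constructor <;> nlinarith

lemma XS.total {k : ℕ} {P : Set (ℕ → Fin k)} {x y : ℕ → Fin k} {a c : ℕ → ℕ} (H : XS P x y a c)
    (z : ℕ → Fin k) (m n : ℕ) (f : ℝ) (h0 : 0 ≤ f) (h1 : f ≤ 1)
    (hf : cnt (VV y z m) 0 (n + 1) = f * (n + 1)) :
    |cnt (VV x z m) 0 (a (n + 1)) - f * (a (n + 1))| ≤
      (a n + c n) + (a n)^2 * (m + 1) + a n := by
  rw [H.ha, mul_comm (n+1)]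
  rw [cnt_add, cnt_add, cnt_add]
  simp only [zero_add]
  have e1 := cnt_err (VV x z m) 0 (a n) f h0 h1
  have e2 := cnt_err (VV x z m) (a n) (c n) f h0 h1
  have e3 := H.blocks z m n _ le_rfl f hf
  have e4 := cnt_err (VV x z m) (a n + c n + a n ^ 2 * (n+1)) (a n) f h0 h1
  push_cast at *
  rw [abs_le] at *
  constructor <;> nlinarith

set_option maxHeartbeats 1000000 in
lemma XS.mid {k : ℕ} {P : Set (ℕ → Fin k)} {x y : ℕ → Fin k} {a c : ℕ → ℕ} (H : XS P x y a c)
    (z : ℕ → Fin k) (m n : ℕ) (f ε δ : ℝ) (hε : 0 < ε) (h0 : 0 ≤ f) (h1 : f ≤ 1)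
    (hf : cnt (VV y z m) 0 (n + 1) = f * (n + 1))
    (hc : (c n : ℝ) ≤ ε * a n) (hm : (m : ℝ) + 1 ≤ ε * (n + 1)) (hn : (n : ℝ) + 1 ≤ ε * a n)
    (ha : |cnt (VV x z m) 0 (a n) - f * a n| ≤ δ * a n) (hδ : 0 ≤ δ)
    (t : ℕ) (ht1 : a n ≤ t) (ht2 : t ≤ a (n + 1)) :
    |cnt (VV x z m) 0 t - f * t| ≤ (δ + 4 * ε) * t := by
  obtain ⟨t1, rfl⟩ := Nat.exists_eq_add_of_le ht1
  rw [cnt_add]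
  have e2 : ∀ N, N ≤ c n → |cnt (VV x z m) (a n) N - f * N| ≤ ε * a n := fun N hN =>
    (cnt_err (VV x z m) (a n) N f h0 h1).trans (le_trans (by exact_mod_cast hN) hc)
  have hT : (0:ℝ) ≤ t1 := by positivity
  have hA : (0:ℝ) ≤ a n := by positivity
  have hp1 := mul_nonneg hε.le hA
  have hp2 := mul_nonneg hε.le hT
  have hp3 := mul_nonneg hδ hT
  rcases le_total t1 (c n) with hle | hle
  · have e3 := e2 t1 hle
    simp only [zero_add]
    push_cast
    rw [abs_le] at *
    constructor <;> nlinarith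
  obtain ⟨t2, rfl⟩ := Nat.exists_eq_add_of_le hle
  rw [cnt_add]
  simp only [zero_add]
  have e3 := e2 (c n) le_rfl
  rcases le_or_gt t2 ((a n)^2 * (n+1)) with hle2 | hle2
  · have hq : t2 / (n+1) ≤ a n ^ 2 := Nat.div_le_of_le_mul (by linarith)
    have hs : t2 % (n+1) < n+1 := Nat.mod_lt _ (by omega)
    have hd : t2 = t2 / (n+1) * (n+1) + t2 % (n+1) := by
      rw [mul_comm]; exact (Nat.div_add_mod _ _).symm
    generalize t2 / (n+1) = q at *
    generalize t2 % (n+1) = s at *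
    subst hd
    rw [cnt_add]
    have e4 := H.blocks z m n q hq f hf
    have e5 := cnt_err (VV x z m) (a n + c n + q * (n+1)) s f h0 h1
    have e6 : (s:ℝ) ≤ n + 1 := by exact_mod_cast hs.le
    have e7 : (q:ℝ) * (m+1) ≤ ε * (q * (n+1)) := by
      have : (0:ℝ) ≤ q := by positivity
      nlinarith
    have e8 : 0 ≤ ε * s := by positivity
    have e9 : 0 ≤ ε * (q * (n+1)) := by positivity
    have e10 : 0 ≤ ε * c n := by positivity
    push_cast at *
    rw [abs_le] at *
    constructor <;> nlinarith
  · obtain ⟨t3, rfl⟩ := Nat.exists_eq_add_of_le hle2.le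
    rw [cnt_add]
    have e4 := H.blocks z m n _ le_rfl f hf
    rw [H.ha, mul_comm (n+1)] at ht2
    have ht3 : t3 ≤ a n := by omega
    have e5 := cnt_err (VV x z m) (a n + c n + a n ^ 2 * (n+1)) t3 f h0 h1
    have e6 : (t3:ℝ) ≤ a n := by exact_mod_cast ht3
    have e7 : ((a n ^ 2 : ℕ):ℝ) * (m+1) ≤ ε * ((a n ^ 2 : ℕ) * (n+1)) := by
      have : (0:ℝ) ≤ (a n ^ 2 : ℕ) := by positivity
      nlinarith
    have e8 : 0 ≤ ε * t3 := by positivity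
    have e10 : 0 ≤ ε * c n := by positivity
    have hn1 : (0:ℝ) ≤ n := by positivity
    have e11 : (a n : ℝ) ≤ ε * (a n ^ 2 * (n+1)) := by
      have : (a n:ℝ) * (n + 1) ≤ a n * (ε * a n) := by nlinarith
      have h5 : ε * (a n:ℝ)^2 ≤ ε * (a n ^ 2 * (n+1)) := by
        have : 0 ≤ ε * (a n:ℝ)^2 * n := by positivity
        nlinarith
      nlinarith
    have e12 : 0 ≤ δ * ((a n:ℝ) ^ 2 * (n+1)) := by positivity
    have e13 : 0 ≤ δ * (c n:ℝ) := by positivity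
    have e14 : 0 ≤ δ * (t3:ℝ) := by positivity
    have e15 : 0 ≤ ε * ((a n:ℝ) ^ 2 * (n+1)) := by positivity
    clear hp1 hp2 hp3 hT hle ht1 hle2 ht2 e2
    push_cast at *
    rw [abs_le] at *
    constructor <;> linarith

set_option maxHeartbeats 2000000 in
lemma XS.key {k : ℕ} {P : Set (ℕ → Fin k)} {x y : ℕ → Fin k} {a c : ℕ → ℕ} (H : XS P x y a c)
    (z : ℕ → Fin k) (m : ℕ) (ε : ℝ) (hε : 0 < ε) : ∀ᶠ n : ℕ in Filter.atTop,
    ∀ t : ℕ, a n ≤ t → t ≤ a (n + 1) →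
      |cnt (VV x z m) 0 t - cnt (VV y z m) 0 (n + 1) / (n + 1) * t| ≤ ε * t := by
  have hη : 0 < min (ε / 9) 1 := by positivity
  have hη1 : min (ε / 9) 1 ≤ 1 := min_le_right _ _
  have hη2 : min (ε / 9) 1 ≤ ε / 9 := min_le_left _ _
  generalize min (ε / 9) 1 = η at *
  have ev := H.ev m η hη
  have ev2 := (Filter.tendsto_sub_atTop_nat 1).eventually ev
  filter_upwards [ev, ev2, Filter.eventually_ge_atTop 1] with n h1 h2 h3 t ht1 ht2
  obtain ⟨n, rfl⟩ : ∃ n', n = n' + 1 := ⟨n - 1, by omega⟩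
  simp only [Nat.add_sub_cancel] at h2
  have fb : ∀ j : ℕ, 0 ≤ cnt (VV y z m) 0 (j + 1) / (j + 1) ∧
      cnt (VV y z m) 0 (j + 1) / (j + 1) ≤ 1 ∧
      cnt (VV y z m) 0 (j + 1) = cnt (VV y z m) 0 (j + 1) / (j + 1) * (j + 1) := by
    intro j
    have e1 := cnt_div_nonneg (VV y z m) 0 (j+1)
    have e2 := cnt_div_le (VV y z m) 0 (j+1)
    push_cast at e1 e2
    have : (j:ℝ) + 1 ≠ 0 := by positivity
    exact ⟨e1, e2, by field_simp⟩
  obtain ⟨f0, f1, f2⟩ := fb n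
  obtain ⟨g0, g1, g2⟩ := fb (n+1)
  have tot := H.total z m n _ f0 f1 f2
  have hd : cnt (VV y z m) 0 (n + 1 + 1) - cnt (VV y z m) 0 (n + 1) ∈ Set.Icc (0:ℝ) 1 := by
    rw [cnt_add (VV y z m) 0 (n+1) 1]
    have e1 := cnt_nonneg (VV y z m) (0 + (n+1)) 1
    have e2 := cnt_le (VV y z m) (0 + (n+1)) 1
    push_cast at e2
    constructor <;> linarith
  generalize cnt (VV y z m) 0 (n + 1) / (n + 1) = f at *
  generalize hg : cnt (VV y z m) 0 (n + 1 + 1) / ((n + 1 : ℕ) + 1) = g at *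
  rw [g2, f2] at hd
  obtain ⟨h1a, h1b, h1c⟩ := h1
  obtain ⟨h2a, h2b, h2c⟩ := h2
  push_cast at *
  have hmm : (0:ℝ) ≤ m := by positivity
  have hnn : (0:ℝ) ≤ n := by positivity
  have hfg : |f - g| ≤ η := by
    have hN : (0:ℝ) < n + 1 + 1 := by positivity
    have e1 : |f - g| * (n + 1 + 1) ≤ 1 := by
      rw [← abs_of_pos hN, ← abs_mul, abs_le]
      obtain ⟨hd1, hd2⟩ := hd
      constructor <;> nlinarith
    by_contra hcon
    push Not at hcon
    have : η * (n+1+1) < |f-g| * (n+1+1) := mul_lt_mul_of_pos_right hcon hN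
    nlinarith
  have hAr : (a (n+1) : ℝ) = a n + c n + (n+1) * (a n)^2 + a n := by
    rw [H.ha]; push_cast; ring
  have hA : (0:ℝ) ≤ a n := by positivity
  have hA1 : (0:ℝ) ≤ a (n+1) := by positivity
  have s1 : (a n:ℝ)^2 * (m+1) ≤ η * a (n+1) := by
    have q1 : (a n:ℝ)^2 * (m+1) ≤ (a n:ℝ)^2 * (η * (n+1)) := by
      apply mul_le_mul_of_nonneg_left h2b; positivity
    have q2 : 0 ≤ η * (a n + c n + a n) := by positivity
    rw [hAr]; nlinarith
  have s2 : (a n:ℝ) ≤ η * a (n+1) := by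
    have q1 : (a n:ℝ) * (n + 1) ≤ a n * (η * a n) := by
      apply mul_le_mul_of_nonneg_left h2c; positivity
    have q3 : 0 ≤ (a n:ℝ) * n := by positivity
    have q4 : 0 ≤ η * (a n)^2 * n := by positivity
    have q2 : 0 ≤ η * (a n + c n + a n) := by positivity
    rw [hAr]; nlinarith
  have s3 : (c n:ℝ) ≤ η * a (n+1) := by
    refine h2a.trans ?_
    nlinarith
  have hEa : |cnt (VV x z m) 0 (a (n+1)) - g * a (n+1)| ≤ (5 * η) * a (n+1) := by
    have : |(f - g) * a (n+1)| ≤ η * a (n+1) := by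
      rw [abs_mul, abs_of_nonneg hA1]
      exact mul_le_mul_of_nonneg_right hfg hA1
    rw [abs_le] at *
    constructor <;> nlinarith
  have := H.mid z m (n+1) g η (5 * η) hη g0 g1 (by push_cast; exact g2) h1a (by push_cast; linarith)
    (by push_cast; linarith) hEa (by positivity) t ht1 ht2
  refine this.trans ?_
  have : (0:ℝ) ≤ t := by positivity
  nlinarith

lemma XS.lower_iff {k : ℕ} {P : Set (ℕ → Fin k)} {x y : ℕ → Fin k} {a c : ℕ → ℕ}
    (H : XS P x y a c) (z : ℕ → Fin k) (m : ℕ) :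
    0 < lowerDensity (VV x z m) ↔ 0 < lowerDensity (VV y z m) := by
  rw [lower_pos, lower_pos]
  constructor
  · rintro ⟨e, he, h⟩
    refine ⟨e / 2, by positivity, ?_⟩
    have h1 := H.key z m (e/2) (by positivity)
    have h2 := (H.a_mono.tendsto_atTop.comp (Filter.tendsto_add_atTop_nat 1)).eventually h
    have h3 := (Filter.tendsto_sub_atTop_nat 1).eventually (h1.and h2)
    filter_upwards [h3, Filter.eventually_ge_atTop 1] with n hn h4
    obtain ⟨n, rfl⟩ : ∃ n', n = n' + 1 := ⟨n - 1, by omega⟩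
    simp only [Nat.add_sub_cancel, Function.comp] at hn
    obtain ⟨hn1, hn2⟩ := hn
    have h5 := (abs_le.1 (hn1 (a (n+1)) (H.a_mono.monotone (by omega)) le_rfl)).2
    have hpos : (0:ℝ) < a (n+1) := by have := H.a_ge (n+1); exact_mod_cast (by omega)
    have h6 : e / 2 ≤ cnt (VV y z m) 0 (n + 1) / (n + 1) := by
      by_contra hcon
      push Not at hcon
      nlinarith
    rw [le_div_iff₀ (by positivity)] at h6
    push_cast; exact h6
  · rintro ⟨e, he, h⟩
    refine ⟨e / 2, by positivity, ?_⟩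
    have h1 := H.key z m (e/2) (by positivity)
    have h2 := (Filter.tendsto_add_atTop_nat 1).eventually h
    obtain ⟨K, hK⟩ := Filter.eventually_atTop.1 (h1.and h2)
    filter_upwards [Filter.eventually_ge_atTop (a K)] with t ht
    obtain ⟨n, hn, hn1, hn2⟩ := H.locate K t ht
    obtain ⟨h3, h4⟩ := hK n hn
    have h5 := (abs_le.1 (h3 t hn1 hn2)).1
    push_cast at h4
    rw [← le_div_iff₀ (by positivity)] at h4
    have : (0:ℝ) ≤ t := by positivity
    nlinarith

lemma XS.upper_iff {k : ℕ} {P : Set (ℕ → Fin k)} {x y : ℕ → Fin k} {a c : ℕ → ℕ}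
    (H : XS P x y a c) (z : ℕ → Fin k) (m : ℕ) :
    0 < upperDensity (VV x z m) ↔ 0 < upperDensity (VV y z m) := by
  rw [upper_pos, upper_pos]
  constructor
  · rintro ⟨e, he, h⟩
    refine ⟨e / 2, by positivity, ?_⟩
    obtain ⟨K, hK⟩ := Filter.eventually_atTop.1 (H.key z m (e/2) (by positivity))
    rw [Filter.frequently_atTop] at h ⊢
    intro N
    obtain ⟨t, ht, ht2⟩ := h (a (max K N))
    obtain ⟨n, hn, hn1, hn2⟩ := H.locate _ t ht
    have h5 := (abs_le.1 (hK n (le_trans (le_max_left _ _) hn) t hn1 hn2)).2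
    have hpos : (0:ℝ) < t := by have := H.a_ge n; exact_mod_cast (by omega)
    refine ⟨n + 1, by have := le_max_right K N; omega, ?_⟩
    have h6 : e / 2 ≤ cnt (VV y z m) 0 (n + 1) / (n + 1) := by
      by_contra hcon
      push Not at hcon
      nlinarith
    rw [le_div_iff₀ (by positivity)] at h6
    push_cast; exact h6
  · rintro ⟨e, he, h⟩
    refine ⟨e / 2, by positivity, ?_⟩
    obtain ⟨K, hK⟩ := Filter.eventually_atTop.1 (H.key z m (e/2) (by positivity))
    rw [Filter.frequently_atTop] at h ⊢
    intro N
    obtain ⟨n, hn, hn2⟩ := h (max K N + 1)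
    obtain ⟨n, rfl⟩ : ∃ n', n = n' + 1 := ⟨n - 1, by omega⟩
    have hn' : max K N ≤ n := by omega
    refine ⟨a (n+1), ?_, ?_⟩
    · have := H.a_ge (n+1); have := le_max_right K N; omega
    have h5 := (abs_le.1 (hK n (le_trans (le_max_left _ _) hn') (a (n+1))
      (H.a_mono.monotone (by omega)) le_rfl)).1
    push_cast at hn2
    rw [← le_div_iff₀ (by positivity)] at hn2
    have : (0:ℝ) ≤ a (n+1) := by positivity
    nlinarith

end density

section badcount

/-- number of constant `L`-blocks inside `[u, u+N)` -/
noncomputable def bd {k : ℕ} (L : ℕ) (x : ℕ → Fin k) (u N : ℕ) : ℝ :=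
  open Classical in
  ∑ i ∈ Finset.range N, if i + L ≤ N ∧ ∀ j < L, x (u + i + j) = x (u + i) then (1 : ℝ) else 0

lemma bd_nonneg {k : ℕ} (L : ℕ) (x : ℕ → Fin k) (u N : ℕ) : 0 ≤ bd L x u N :=
  Finset.sum_nonneg fun i _ => by split_ifs <;> norm_num

lemma bd_le {k : ℕ} (L : ℕ) (x : ℕ → Fin k) (u N : ℕ) : bd L x u N ≤ N := by
  unfold bd
  refine (Finset.sum_le_card_nsmul _ _ 1 ?_).trans (by simp)
  intro i _
  split_ifs <;> norm_num

lemma sum_short (M L : ℕ) :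
    (∑ i ∈ Finset.range M, if M < i + L then (1:ℝ) else 0) ≤ L := by
  rw [Finset.sum_boole]
  have : (Finset.range M).filter (fun i => M < i + L) ⊆ Finset.Ico (M - L) M := by
    intro s hs
    simp at hs ⊢
    omega
  have := Finset.card_le_card this
  rw [Nat.card_Ico] at this
  exact_mod_cast (by omega : _ ≤ L)

lemma bd_add {k : ℕ} (L : ℕ) (x : ℕ → Fin k) (u M N : ℕ) :
    bd L x u (M + N) ≤ bd L x u M + bd L x (u + M) N + L := by
  classical
  have hs := sum_short M L
  unfold bd
  rw [Finset.sum_range_add]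
  have h2 : ∀ i ∈ Finset.range N,
      (if M + i + L ≤ M + N ∧ ∀ j < L, x (u + (M + i) + j) = x (u + (M + i)) then (1:ℝ) else 0) =
      (if i + L ≤ N ∧ ∀ j < L, x (u + M + i + j) = x (u + M + i) then (1:ℝ) else 0) := by
    intro i _
    refine if_congr ?_ rfl rfl
    rw [← add_assoc u M i]
    refine and_congr ?_ Iff.rfl
    omega
  have h1 : ∀ i ∈ Finset.range M,
      (if i + L ≤ M + N ∧ ∀ j < L, x (u + i + j) = x (u + i) then (1:ℝ) else 0) ≤
      (if i + L ≤ M ∧ ∀ j < L, x (u + i + j) = x (u + i) then (1:ℝ) else 0) +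
        (if M < i + L then (1:ℝ) else 0) := by
    intro i _
    by_cases h : M < i + L
    · rw [if_pos h]
      have : (0:ℝ) ≤ (if i + L ≤ M ∧ ∀ j < L, x (u + i + j) = x (u + i) then (1:ℝ) else 0) := by
        split_ifs <;> norm_num
      refine le_trans ?_ (le_add_of_nonneg_left this)
      split_ifs <;> norm_num
    · rw [if_neg h, add_zero]
      refine le_of_eq (if_congr ?_ rfl rfl)
      refine and_congr ?_ Iff.rfl
      omega
  have e1 := Finset.sum_le_sum h1
  have e2 := Finset.sum_congr rfl h2
  rw [Finset.sum_add_distrib] at e1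
  linarith

lemma bd_congr {k : ℕ} (L : ℕ) (x x' : ℕ → Fin k) (u u' N : ℕ) (hL : 1 ≤ L)
    (h : ∀ i < N, x (u + i) = x' (u' + i)) : bd L x u N = bd L x' u' N := by
  classical
  unfold bd
  refine Finset.sum_congr rfl fun i _ => if_congr (and_congr_right fun hi => ?_) rfl rfl
  refine forall_congr' fun j => forall_congr' fun hj => ?_
  rw [add_assoc, add_assoc, h _ (by omega), h _ (by omega)]

lemma bd_legal {k : ℕ} (L : ℕ) (p : ℕ → Fin k) (hp : p ∈ PiL k L) (u N : ℕ) :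
    bd L p u N = 0 := by
  classical
  unfold bd
  refine Finset.sum_eq_zero fun i _ => if_neg ?_
  rintro ⟨_, h⟩
  obtain ⟨j1, j2, h1, h2, hne⟩ := hp (u + i)
  exact hne ((h j1 h1).trans (h j2 h2).symm)

variable {k L : ℕ} {x y : ℕ → Fin k} {a c : ℕ → ℕ}

lemma XS.inC (H : XS (PiL k L) x y a c) (hL : 1 ≤ L) (n u N : ℕ) (h1 : a n ≤ u)
    (h2 : u + N ≤ a n + c n) : bd L x u N = 0 := by
  obtain ⟨p, hp, hC⟩ := H.hC n
  rw [bd_congr L x p u (u - a n) N hL, bd_legal L p hp]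
  intro i hi
  rw [← hC _ (by omega)]
  congr 1; omega

lemma XS.inY (H : XS (PiL k L) x y a c) (hL : 1 ≤ L) (hy : y ∈ PiL k L) (n q s N : ℕ)
    (hq : q < (a n)^2) (h2 : s + N ≤ n + 1) :
    bd L x (a n + c n + q * (n+1) + s) N = 0 := by
  rw [bd_congr L x y _ s N hL, bd_legal L y hy]
  intro i hi
  rw [add_assoc _ s i, H.hY n q hq _ (by omega)]

lemma XS.aligned (H : XS (PiL k L) x y a c) (hL : 1 ≤ L) (hy : y ∈ PiL k L) (n : ℕ) (N : ℕ) :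
    ∀ q, q * (n+1) + N ≤ (a n)^2 * (n+1) →
    bd L x (a n + c n + q * (n+1)) N ≤ L * N / (n+1) := by
  induction N using Nat.strong_induction_on with
  | _ N ih =>
    intro q hN
    rcases Nat.eq_zero_or_pos N with h0 | h0
    · subst h0; simp [bd]
    have hq : q < (a n)^2 := by
      by_contra hcon
      push Not at hcon
      have := Nat.mul_le_mul_right (n+1) hcon
      omega
    rcases le_total N (n+1) with h | h
    · have := H.inY hL hy n q 0 N hq (by omega)
      rw [add_zero] at this
      rw [this]; positivity
    · obtain ⟨N', rfl⟩ := Nat.exists_eq_add_of_le h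
      have e1 := bd_add L x (a n + c n + q * (n+1)) (n+1) N'
      have e2 := H.inY hL hy n q 0 (n+1) hq (by omega)
      have e3 := ih N' (by omega) (q+1) (by rw [Nat.succ_mul]; omega)
      rw [Nat.succ_mul, ← add_assoc] at e3
      rw [add_zero] at e2
      have e4 : (L:ℝ) * ((n + 1 + N' : ℕ):ℝ) / (n+1) = L + L * N' / (n+1) := by
        push_cast; field_simp
      rw [e4]; linarith

lemma XS.inYs (H : XS (PiL k L) x y a c) (hL : 1 ≤ L) (hy : y ∈ PiL k L) (n o N : ℕ)
    (h : o + N ≤ (a n)^2 * (n+1)) :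
    bd L x (a n + c n + o) N ≤ L * N / (n+1) + L := by
  rcases Nat.eq_zero_or_pos N with h0 | h0
  · subst h0; simp [bd]
  have hs : o % (n+1) < n+1 := Nat.mod_lt _ (by omega)
  have hd : o = o / (n+1) * (n+1) + o % (n+1) := by
    rw [mul_comm]; exact (Nat.div_add_mod _ _).symm
  generalize o / (n+1) = q at *
  generalize o % (n+1) = s at *
  subst hd
  have hq : q < (a n)^2 := by
    by_contra hcon
    push Not at hcon
    have := Nat.mul_le_mul_right (n+1) hcon
    omega
  rw [← add_assoc]
  rcases le_total (s + N) (n+1) with h1 | h1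
  · rw [H.inY hL hy n q s N hq h1]; positivity
  · obtain ⟨N', rfl⟩ : ∃ N', N = (n + 1 - s) + N' := ⟨N - (n+1-s), by omega⟩
    have e1 := bd_add L x (a n + c n + q * (n+1) + s) (n+1-s) N'
    have e2 := H.inY hL hy n q s (n+1-s) hq (by omega)
    have e3 := H.aligned hL hy n N' (q+1) (by rw [Nat.succ_mul]; omega)
    rw [Nat.succ_mul, ← add_assoc] at e3
    rw [show a n + c n + q * (n+1) + s + (n+1-s) = a n + c n + q * (n+1) + (n+1) by omega] at e1
    have e4 : (L:ℝ) * N' / (n+1) ≤ L * ((n + 1 - s + N' : ℕ):ℝ) / (n+1) := by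
      gcongr
      omega
    linarith

lemma XS.inM (H : XS (PiL k L) x y a c) (hL : 1 ≤ L) (hy : y ∈ PiL k L) (n u N : ℕ)
    (ε : ℝ) (hε : 0 < ε) (hn : (L:ℝ) ≤ ε * (n+1))
    (h1 : a n ≤ u) (h2 : u + N ≤ a n + c n + (n+1) * (a n)^2) :
    bd L x u N ≤ ε * N + 2 * L := by
  rw [mul_comm (n+1)] at h2
  have hr : ∀ N : ℕ, (L:ℝ) * N / (n+1) ≤ ε * N := by
    intro N
    rw [div_le_iff₀ (by positivity)]
    have : (0:ℝ) ≤ N := by positivity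
    nlinarith
  have hN := hr N
  have hLp : (0:ℝ) ≤ L := by positivity
  rcases le_total (u + N) (a n + c n) with h3 | h3
  · rw [H.inC hL n u N h1 h3]; positivity
  rcases le_total (a n + c n) u with h4 | h4
  · obtain ⟨o, rfl⟩ := Nat.exists_eq_add_of_le h4
    have := H.inYs hL hy n o N (by omega)
    linarith
  · obtain ⟨N', rfl⟩ : ∃ N', N = (a n + c n - u) + N' := ⟨N - (a n + c n - u), by omega⟩
    have e1 := bd_add L x u (a n + c n - u) N'
    have e0 := H.inC hL n u (a n + c n - u) h1 (by omega)
    rw [e0, show u + (a n + c n - u) = a n + c n + 0 by omega] at e1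
    have e2 := H.inYs hL hy n 0 N' (by omega)
    have e3 := hr N'
    have e4 : ε * (N':ℝ) ≤ ε * ((a n + c n - u + N' : ℕ):ℝ) := by
      gcongr
      omega
    linarith

lemma XS.tr (H : XS (PiL k L) x y a c) (hL : 1 ≤ L) (n u N : ℕ) (h : u + N ≤ a n) :
    bd L x (a n + c n + (n+1) * (a n)^2 + u) N = bd L x u N := by
  refine bd_congr L x x _ _ N hL fun i hi => ?_
  rw [add_assoc _ u i, H.hA n _ (by omega)]

lemma XS.allbd (H : XS (PiL k L) x y a c) (hL : 1 ≤ L) (hy : y ∈ PiL k L) (n0 : ℕ)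
    (ε : ℝ) (hε : 0 < ε) (hn0 : (L:ℝ) ≤ ε * (n0+1))
    (hT : bd L x 0 (a n0) ≤ ε * a n0 - 4 * L) (n : ℕ) (hn : n0 ≤ n) :
    bd L x 0 (a n) ≤ ε * a n - 4 * L ∧
    (∀ v ≤ a n, bd L x 0 v ≤ ε * v + (a n0 + 4 * L)) ∧
    (∀ u N, u + N = a n → bd L x u N ≤ ε * N + (a n0 + 4 * L)) ∧
    (∀ u N, u + N ≤ a n → bd L x u N ≤ ε * N + (2 * a n0 + 12 * L)) := by
  have hLp : (0:ℝ) ≤ L := by positivity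
  have hAp : (0:ℝ) ≤ a n0 := by positivity
  induction n, hn using Nat.le_induction with
  | base =>
    have key : ∀ u N, u + N ≤ a n0 → bd L x u N ≤ ε * N + a n0 := by
      intro u N h
      have e1 := bd_le L x u N
      have e2 : (N:ℝ) ≤ a n0 := by exact_mod_cast (by omega : N ≤ a n0)
      have e3 : 0 ≤ ε * N := by positivity
      linarith
    refine ⟨hT, fun v hv => ?_, fun u N h => ?_, fun u N h => ?_⟩
    · have := key 0 v (by omega); linarith
    · have := key u N (by omega); linarith
    · have := key u N (by omega); linarith
  | succ n hn ih =>
    obtain ⟨i1, i2, i3, i4⟩ := ih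
    have hnn : (L:ℝ) ≤ ε * (n+1) := by
      have : (n0:ℝ) ≤ n := by exact_mod_cast hn
      nlinarith
    have hM := fun u N => H.inM hL hy n u N ε hε hnn
    have htr := H.tr hL n
    have haeq := H.ha n
    obtain ⟨M, hMd⟩ : ∃ M, M = c n + (n+1) * (a n)^2 := ⟨_, rfl⟩
    have hb : a n + c n + (n+1) * (a n)^2 = a n + M := by omega
    rw [hb] at haeq htr
    simp only [hb] at hM
    have htr0 := htr 0 (a n) (by omega)
    rw [add_zero] at htr0
    have hMM := hM (a n) M le_rfl le_rfl
    have haM := bd_add L x 0 (a n) M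
    rw [zero_add] at haM
    rw [haeq]
    refine ⟨?_, fun v hv => ?_, fun u N h => ?_, fun u N h => ?_⟩
    · have e1 := bd_add L x 0 (a n + M) (a n)
      rw [zero_add, htr0] at e1
      push_cast
      linarith
    · rcases le_total v (a n) with h1 | h1
      · exact i2 v h1
      obtain ⟨v, rfl⟩ := Nat.exists_eq_add_of_le h1
      rcases le_total v M with h2 | h2
      · have e1 := bd_add L x 0 (a n) v
        rw [zero_add] at e1
        have e2 := hM (a n) v le_rfl (by omega)
        push_cast
        linarith
      · obtain ⟨v, rfl⟩ := Nat.exists_eq_add_of_le h2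
        have e1 := bd_add L x 0 (a n + M) v
        have e3 := htr 0 v (by omega)
        rw [add_zero] at e3
        rw [zero_add, e3] at e1
        have e2 := i2 v (by omega)
        rw [← add_assoc]
        push_cast
        linarith
    · rcases le_total (a n + M) u with h1 | h1
      · obtain ⟨u, rfl⟩ := Nat.exists_eq_add_of_le h1
        rw [htr u N (by omega)]
        exact i3 u N (by omega)
      obtain ⟨N, rfl⟩ : ∃ N', N = (a n + M - u) + N' := ⟨N - (a n + M - u), by omega⟩
      obtain rfl : N = a n := by omega
      have e1 := bd_add L x u (a n + M - u) (a n)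
      rw [Nat.add_sub_cancel' h1, htr0] at e1
      rcases le_total (a n) u with h2 | h2
      · have e2 := hM u (a n + M - u) h2 (by omega)
        push_cast at *
        linarith
      · have e2 := bd_add L x u (a n - u) M
        rw [Nat.add_sub_cancel' h2] at e2
        have e3 := i3 u (a n - u) (by omega)
        rw [show a n + M - u = a n - u + M by omega] at *
        push_cast at *
        linarith
    · rcases le_total (u + N) (a n) with h1 | h1
      · exact i4 u N h1
      rcases le_total (a n + M) u with h2 | h2
      · obtain ⟨u, rfl⟩ := Nat.exists_eq_add_of_le h2
        rw [htr u N (by omega)]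
        exact i4 u N (by omega)
      have hleft : ∀ N, u + N ≤ a n + M → a n ≤ u + N →
          bd L x u N ≤ ε * N + (a n0 + 7 * L) := by
        intro N h3 h5
        rcases le_total (a n) u with h4 | h4
        · have e2 := hM u N h4 h3
          linarith
        · obtain ⟨N, rfl⟩ : ∃ N', N = (a n - u) + N' := ⟨N - (a n - u), by omega⟩
          have e2 := bd_add L x u (a n - u) N
          rw [Nat.add_sub_cancel' h4] at e2
          have e3 := i3 u (a n - u) (by omega)
          have e4 := hM (a n) N le_rfl (by omega)
          push_cast at *
          linarith
      rcases le_total (u + N) (a n + M) with h3 | h3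
      · have := hleft N h3 h1
        linarith
      · obtain ⟨N, rfl⟩ : ∃ N', N = (a n + M - u) + N' := ⟨N - (a n + M - u), by omega⟩
        have e1 := bd_add L x u (a n + M - u) N
        have e3 := htr 0 N (by omega)
        rw [add_zero] at e3
        rw [Nat.add_sub_cancel' h2, e3] at e1
        have e2 := hleft (a n + M - u) (by omega) (by omega)
        have e4 := i2 N (by omega)
        rw [Nat.cast_add]
        linarith

lemma XS.bad_zero (H : XS (PiL k L) x y a c) (hL : 1 ≤ L) (hy : y ∈ PiL k L)
    (ε : ℝ) (hε : 0 < ε) : ∃ K : ℝ, ∀ u N, bd L x u N ≤ ε * N + K := by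
  obtain ⟨n, hn⟩ := exists_nat_gt ((2 + 8 * (L:ℝ)) / (ε / 2))
  rw [div_lt_iff₀ (by positivity)] at hn
  have hLp : (0:ℝ) ≤ L := by positivity
  have hT : bd L x 0 (a (n+1)) ≤ ε * a (n+1) - 4 * L := by
    have e1 := bd_add L x 0 (a n + (c n + (n+1) * (a n)^2)) (a n)
    have e2 := bd_add L x 0 (a n) (c n + (n+1) * (a n)^2)
    have e3 := bd_le L x 0 (a n)
    have e4 := bd_le L x (0 + (a n + (c n + (n+1) * (a n)^2))) (a n)
    rw [zero_add] at e2
    have e5 := H.inM hL hy n (a n) (c n + (n+1) * (a n)^2) (ε/2) (by positivity)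
      (by nlinarith) le_rfl (by omega)
    have hA : (1:ℝ) ≤ a n := by have := H.a_ge n; exact_mod_cast (by omega : 1 ≤ a n)
    have e6 : 2 * (a n:ℝ) + 8 * L ≤ (ε / 2) * ((n+1) * (a n)^2) := by
      have q1 : 2 * (a n:ℝ) + 8 * L ≤ (2 + 8 * L) * a n := by nlinarith
      have q2 : (a n:ℝ) ≤ (a n)^2 := by nlinarith
      have q3 : (2 + 8 * L) * (a n:ℝ) ≤ (2 + 8 * L) * (a n)^2 :=
        mul_le_mul_of_nonneg_left q2 (by positivity)
      have q4 : (2 + 8 * (L:ℝ)) * (a n:ℝ)^2 ≤ (n * (ε/2)) * (a n)^2 :=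
        mul_le_mul_of_nonneg_right hn.le (by positivity)
      have q5 : 0 ≤ ε / 2 * (a n:ℝ)^2 := by positivity
      linarith
    have e7 : 0 ≤ ε * (c n:ℝ) := by positivity
    have e8 : 0 ≤ ε * (a n:ℝ) := by positivity
    rw [H.ha, show a n + c n + (n+1) * (a n)^2 + a n = a n + (c n + (n+1) * (a n)^2) + a n by omega]
    push_cast at *
    linarith
  refine ⟨2 * a (n+1) + 12 * L, fun u N => ?_⟩
  have hj := H.a_ge (u + N + (n+1))
  exact (H.allbd hL hy (n+1) ε hε (by push_cast; nlinarith) hT (u + N + (n+1)) (by omega)).2.2.2 u N (by omega)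

lemma XS.bu_sub (H : XS (PiL k L) x y a c) (hL : 1 ≤ L) (hy : y ∈ PiL k L) :
    statOmega banachUpperDensity x ⊆ PiL k L := by
  classical
  intro z hz i
  by_contra hcon
  push Not at hcon
  have h1 := (stat_iff _ mono_bu x z).1 hz (i + L)
  rw [bupper_pos] at h1
  obtain ⟨e, he, hf⟩ := h1
  obtain ⟨K, hK⟩ := H.bad_zero hL hy (e/2) (by positivity)
  have hcnt : ∀ u N, cnt (VV x z (i + L)) u N ≤ bd L x (u + i) N + L := by
    intro u N
    have hs := sum_short N L
    unfold cnt bd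
    refine le_trans ?_ (add_le_add_right hs _)
    rw [← Finset.sum_add_distrib]
    refine Finset.sum_le_sum fun t _ => ?_
    by_cases ht : u + t ∈ VV x z (i + L)
    · rw [if_pos ht]
      by_cases h2 : N < t + L
      · rw [if_pos h2]
        have : (0:ℝ) ≤ (if t + L ≤ N ∧ ∀ j < L, x (u + i + t + j) = x (u + i + t) then (1:ℝ) else 0) := by
          split_ifs <;> norm_num
        linarith
      · rw [if_neg h2, if_pos]
        · norm_num
        refine ⟨by omega, fun j hj => ?_⟩
        have q1 := ht.2 (i + j) (by omega)
        have q2 := ht.2 (i + 0) (by omega)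
        rw [hcon j 0 hj (by omega), ← q2] at q1
        rw [show u + i + t + j = u + t + (i + j) by omega, show u + i + t = u + t + (i + 0) by omega]
        exact q1
    · rw [if_neg ht]
      refine add_nonneg ?_ ?_ <;> split_ifs <;> norm_num
  obtain ⟨N0, hN0⟩ := exists_nat_gt ((K + L) / (e/2))
  rw [div_lt_iff₀ (by positivity)] at hN0
  obtain ⟨N, hN, u, hu⟩ := (Filter.frequently_atTop.1 hf) N0
  have e1 := hcnt u N
  have e2 := hK (u + i) N
  have e3 : (N0:ℝ) ≤ N := by exact_mod_cast hN
  nlinarith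

end badcount

section final

variable {k L : ℕ} {x y : ℕ → Fin k} {a c : ℕ → ℕ} {P : Set (ℕ → Fin k)}

/-- every word of `y` occurs in `x` -/
lemma XS.copy (H : XS P x y a c) (u N : ℕ) :
    ∃ v, u < v ∧ ∀ j < N, x (v + j) = y (u + j) := by
  have h1 := H.a_ge (u + N)
  refine ⟨a (u+N) + c (u+N) + u, by omega, fun j hj => ?_⟩
  have := H.hY (u+N) 0 (pow_pos (by omega) 2) (u + j) (by omega)
  rw [← this]
  congr 1; omega

lemma XS.omega_sub (H : XS P x y a c) : omegaLim y ⊆ omegaLim x := by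
  intro z hz
  rw [omega_iff] at *
  intro m N
  obtain ⟨n, hn, h⟩ := hz m N
  obtain ⟨v, hv, h2⟩ := H.copy n m
  exact ⟨v, by omega, fun j hj => (h2 j hj).trans (h j hj)⟩

lemma XS.self_mem (H : XS P x y a c) : x ∈ omegaLim x := by
  rw [omega_iff]
  intro m N
  have := H.a_ge (N + m)
  exact ⟨a (N+m) + c (N+m) + (N+m+1) * (a (N+m))^2, by omega, fun j hj => H.hA _ j (by omega)⟩

lemma XS.bu_sup (H : XS P x y a c) :
    statOmega banachUpperDensity y ⊆ statOmega banachUpperDensity x := by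
  intro z hz
  rw [stat_iff _ mono_bu] at *
  intro m
  have := hz m
  rw [bupper_pos] at *
  obtain ⟨e, he, hf⟩ := this
  refine ⟨e, he, hf.mono ?_⟩
  rintro N ⟨u, hu⟩
  obtain ⟨v, hv, h⟩ := H.copy u (N + m)
  refine ⟨v, hu.trans (cnt_mono fun i hi hm => ⟨by omega, fun j hj => ?_⟩)⟩
  rw [← hm.2 j hj, add_assoc, add_assoc, h _ (by omega)]

lemma bl_word (w z p : ℕ → Fin k) (hz : z ∈ statOmega banachLowerDensity w)
    (hp : p ∈ omegaLim w) (m : ℕ) : ∃ s, ∀ j < m, z j = p (s + j) := by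
  classical
  have h1 := (stat_iff _ mono_bl w z).1 hz m
  rw [blower_pos] at h1
  obtain ⟨e, he, hf⟩ := h1
  obtain ⟨N, hN, hpos⟩ := (hf.and (Filter.eventually_gt_atTop 0)).exists
  rw [omega_iff] at hp
  obtain ⟨n, _, hn⟩ := hp (N + m) 0
  have h2 := hN n
  have h3 : 0 < cnt (VV w z m) n N := by
    have : (0:ℝ) < N := by exact_mod_cast hpos
    have := mul_pos he this
    linarith
  by_contra hcon
  push Not at hcon
  have : cnt (VV w z m) n N = 0 := by
    unfold cnt
    refine Finset.sum_eq_zero fun i hi => if_neg fun hm => ?_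
    rw [Finset.mem_range] at hi
    obtain ⟨j, hj, hne⟩ := hcon i
    apply hne
    rw [← hm.2 j hj, add_assoc, hn _ (by omega)]
  linarith

lemma bl_empty (hk : 2 ≤ k) (hL : 3 ≤ L) (w : ℕ → Fin k) (hw : PiL k L ⊆ omegaLim w) :
    statOmega banachLowerDensity w = ∅ := by
  rw [Set.eq_empty_iff_forall_notMem]
  intro z hz
  have h01 : (⟨0, by omega⟩ : Fin k) ≠ ⟨1, by omega⟩ := by simp
  generalize (⟨0, by omega⟩ : Fin k) = s0 at h01
  generalize (⟨1, by omega⟩ : Fin k) = s1 at h01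
  have hp : (fun n => if n % 2 = 0 then s0 else s1) ∈ PiL k L := by
    intro i
    refine ⟨0, 1, by omega, by omega, ?_⟩
    rcases Nat.mod_two_eq_zero_or_one i with h | h
    · simp [h, Nat.add_mod, h01]
    · simp [h, Nat.add_mod, h01.symm]
  have hp' : (fun n => if n % 3 = 0 then s0 else s1) ∈ PiL k L := by
    intro i
    have : i % 3 = 0 ∨ i % 3 = 1 ∨ i % 3 = 2 := by omega
    rcases this with h | h | h
    · exact ⟨0, 1, by omega, by omega, by simp [h, Nat.add_mod, h01]⟩
    · exact ⟨0, 2, by omega, by omega, by simp [h, Nat.add_mod, h01.symm]⟩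
    · exact ⟨0, 1, by omega, by omega, by simp [h, Nat.add_mod, h01.symm]⟩
  obtain ⟨s, hs⟩ := bl_word w z _ hz (hw hp) 4
  obtain ⟨t, ht⟩ := bl_word w z _ hz (hw hp') 4
  have a0 := hs 0 (by omega)
  have a3 := hs 3 (by omega)
  have b0 := ht 0 (by omega)
  have b3 := ht 3 (by omega)
  have e1 : (t + 3) % 3 = (t + 0) % 3 := by omega
  simp only [e1] at b3
  have e2 : z 0 = z 3 := b0.trans b3.symm
  rw [a0, a3] at e2
  have : s % 2 = 0 ∧ (s + 3) % 2 = 1 ∨ s % 2 = 1 ∧ (s+3) % 2 = 0 := by omega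
  rcases this with ⟨q1, q2⟩ | ⟨q1, q2⟩
  · simp [q1, q2] at e2; exact h01 e2
  · simp [q1, q2] at e2; exact h01 e2.symm

end final

/-- **Lemma.** If a transitive point `y` of `Π_L` satisfies Case (i) in `(Π_L, σ)`,
then `T(y)` satisfies Case (i') in `(Σ_k, σ)`, for `i = 1,…,6`. -/
theorem T_maps_case_to_case_prime (k L : ℕ) (hk : 2 ≤ k) (hL : 3 ≤ L)
    (D : TData k (PiL k L)) (hD : D.Small)
    (y : ℕ → Fin k) (hy : y ∈ PiL k L) (htrans : omegaLim y = PiL k L)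
    (i : Fin 6) (hcase : SatCase i y) :
    SatCase' i (D.T y) := by

  have H := T_XS D hD y
  have hBU : statOmega banachUpperDensity y = PiL k L := hcase.2.2.2.trans htrans
  have hbu : statOmega banachUpperDensity (D.T y) = statOmega banachUpperDensity y := by
    refine Set.Subset.antisymm ?_ H.bu_sup
    rw [hBU]
    exact H.bu_sub (by omega) hy
  have hom : PiL k L ⊆ omegaLim (D.T y) :=
    Set.Subset.trans htrans.ge H.omega_sub
  have hbl : statOmega banachLowerDensity (D.T y) = statOmega banachLowerDensity y := by
    rw [bl_empty hk hL _ hom, bl_empty hk hL y htrans.ge]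
  have hl : statOmega lowerDensity (D.T y) = statOmega lowerDensity y := by
    ext z
    rw [stat_iff _ mono_l, stat_iff _ mono_l]
    exact forall_congr' fun m => H.lower_iff z m
  have hu : statOmega upperDensity (D.T y) = statOmega upperDensity y := by
    ext z
    rw [stat_iff _ mono_u, stat_iff _ mono_u]
    exact forall_congr' fun m => H.upper_iff z m
  unfold SatCase'
  rw [hbl, hl, hu, hbu]
  refine ⟨hcase.1, hcase.2.1, hcase.2.2.1, ?_⟩
  rw [hBU]
  refine ⟨hom, fun hsub => D.A1_not ⟨D.T y, hsub H.self_mem, fun i => ?_⟩⟩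
  have := T_get D y 0 i i.2
  have h2 : (D.A1)[(i : ℕ)]? = some (D.T y i) := this
  rw [List.getElem?_eq_getElem i.2] at h2
  exact (Option.some_injective _ h2).symm
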